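/- Let (H, 𝒰, ℰ, 𝒥, σ) be a Z-problem with dim H < ∞, and suppose the compression of σ to 𝒰 ⊕ ℰ is self-adjoint (i.e. σ₀₀* = σ₀₀, σ₁₁* = σ₁₁, and σ₀₁* = σ₁₀) and ker σ₁₁ ⊆ ker σ₀₁. Then for each E₀ ∈ 𝒰 the set of solutions (J₀, E, J) of the Z-problem at E₀ is exactly the set of triples with E = −σ₁₁⁺σ₁₀E₀ + K for some K ∈ ker σ₁₁, J₀ = (σ₀₀ − σ₀₁σ₁₁⁺σ₁₀)E₀, and J = σ₂₀E₀ + σ₂₁E. In particular, every solution at E₀ has the same first component J₀ = (σ₀₀ − σ₀₁σ₁₁⁺σ₁₀)E₀, so the effective operator exists, is unique, and equals the generalized Schur complement σ₀₀ − σ₀₁σ₁₁⁺σ₁₀. -/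

import Mathlib

/-- The generalized Schur complement `σ₀₀ - σ₀₁ σ₁₁⁺ σ₁₀` of an operator `σ` with respect
to orthogonal projections `P0, P1`, where `B` is the Moore–Penrose pseudoinverse of the
block `σ₁₁ = P1 σ P1`. -/
noncomputable def gschurLM {𝕂 : Type*} [RCLike 𝕂] {H : Type*} [NormedAddCommGroup H]
    [InnerProductSpace 𝕂 H] (P0 P1 σ B : H →ₗ[𝕂] H) : H →ₗ[𝕂] H :=
  (P0 ∘ₗ (σ ∘ₗ P0)) - (P0 ∘ₗ (σ ∘ₗ P1)) ∘ₗ (B ∘ₗ (P1 ∘ₗ (σ ∘ₗ P0)))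

/-- If `B` satisfies `B = B S B` with `B S` self-adjoint and `S` is fixed by left composition
with `P`, where `S` is self-adjoint, then so is `B`. -/
theorem comp_pinv_eq_self {𝕂 : Type*} [RCLike 𝕂] {H : Type*} [NormedAddCommGroup H]
    [InnerProductSpace 𝕂 H] [FiniteDimensional 𝕂 H] {P S B : H →ₗ[𝕂] H}
    (hS : LinearMap.adjoint S = S) (hPS : P ∘ₗ S = S)
    (hBSB : B ∘ₗ (S ∘ₗ B) = B) (hBS : LinearMap.adjoint (B ∘ₗ S) = B ∘ₗ S) :
    P ∘ₗ B = B := by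
  have h : S ∘ₗ LinearMap.adjoint B = B ∘ₗ S := by
    rw [← hBS, LinearMap.adjoint_comp, hS]
  have hPBS : P ∘ₗ (B ∘ₗ S) = B ∘ₗ S := by
    rw [← h, ← LinearMap.comp_assoc, hPS]
  calc P ∘ₗ B = (P ∘ₗ (B ∘ₗ S)) ∘ₗ B := by
        simp only [LinearMap.comp_assoc, hBSB]
    _ = B := by rw [hPBS, LinearMap.comp_assoc, hBSB]

/-- If `S` is self-adjoint with `S B S = S` and `S B` self-adjoint, and `ker S ≤ ker T`,
then `S B` fixes the range of `T*`. -/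
theorem comp_pinv_comp_adjoint_eq {𝕂 : Type*} [RCLike 𝕂] {H : Type*} [NormedAddCommGroup H]
    [InnerProductSpace 𝕂 H] [FiniteDimensional 𝕂 H] {S T B : H →ₗ[𝕂] H}
    (hS : LinearMap.adjoint S = S) (hker : LinearMap.ker S ≤ LinearMap.ker T)
    (hSBS : S ∘ₗ (B ∘ₗ S) = S) (hSB : LinearMap.adjoint (S ∘ₗ B) = S ∘ₗ B) :
    (S ∘ₗ B) ∘ₗ LinearMap.adjoint T = LinearMap.adjoint T := by
  have hSSB : S ∘ₗ (S ∘ₗ B) = S := by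
    calc S ∘ₗ (S ∘ₗ B) = LinearMap.adjoint (S ∘ₗ (B ∘ₗ S)) := by
          rw [← LinearMap.comp_assoc S B S, LinearMap.adjoint_comp, hS, hSB]
      _ = S := by rw [hSBS, hS]
  have hTSB : T ∘ₗ (S ∘ₗ B) = T := by
    ext x
    have hx : (S ∘ₗ B) x - x ∈ LinearMap.ker S := by
      rw [LinearMap.mem_ker, map_sub, sub_eq_zero]
      exact LinearMap.congr_fun hSSB x
    have := hker hx
    rwa [LinearMap.mem_ker, map_sub, sub_eq_zero] at this
  rw [← hSB, ← LinearMap.adjoint_comp, hTSB]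

/-- The product of two self-adjoint operators vanishes in either order simultaneously. -/
theorem comp_eq_zero_of_adjoint_eq {𝕂 : Type*} [RCLike 𝕂] {H : Type*} [NormedAddCommGroup H]
    [InnerProductSpace 𝕂 H] [FiniteDimensional 𝕂 H] {P Q : H →ₗ[𝕂] H}
    (hP : LinearMap.adjoint P = P) (hQ : LinearMap.adjoint Q = Q) (h : P ∘ₗ Q = 0) :
    Q ∘ₗ P = 0 := by
  rw [← hP, ← hQ, ← LinearMap.adjoint_comp, h, map_zero]

/-- Solutions of the Z-problem under relaxed hypotheses: the Z-problem
`(H, 𝒰, ℰ, 𝒥, σ)` on a finite-dimensional Hilbert space is encoded by mutually orthogonal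
projections `P0, P1, P2` with sum `1` (ranges `𝒰, ℰ, 𝒥`); the compression of `σ` to
`𝒰 ⊕ ℰ` is self-adjoint (`σ₀₀* = σ₀₀`, `σ₁₁* = σ₁₁`, `σ₀₁* = σ₁₀`), and
`ker σ₁₁ ⊆ ker σ₀₁`; `B = σ₁₁⁺` is the Moore–Penrose pseudoinverse of `σ₁₁`.  Then for
each `E₀ ∈ 𝒰`, the solutions `(J₀, E, J)` of the Z-problem at `E₀` are exactly the
triples with `E = -σ₁₁⁺σ₁₀E₀ + K` (`K ∈ ker σ₁₁`), `J₀ = (σ₀₀ - σ₀₁σ₁₁⁺σ₁₀)E₀`, and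
`J = σ₂₀E₀ + σ₂₁E`; in particular the effective operator is the generalized Schur
complement. -/
theorem stmt_10
    {𝕂 : Type*} [RCLike 𝕂]
    {H : Type*} [NormedAddCommGroup H] [InnerProductSpace 𝕂 H] [FiniteDimensional 𝕂 H]
    (P0 P1 P2 : H →ₗ[𝕂] H)
    (hP0 : P0 ∘ₗ P0 = P0) (hP0sa : LinearMap.adjoint P0 = P0)
    (hP1 : P1 ∘ₗ P1 = P1) (hP1sa : LinearMap.adjoint P1 = P1)
    (hP2 : P2 ∘ₗ P2 = P2) (hP2sa : LinearMap.adjoint P2 = P2)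
    (h01 : P0 ∘ₗ P1 = 0) (h02 : P0 ∘ₗ P2 = 0) (h12 : P1 ∘ₗ P2 = 0)
    (hsum : P0 + P1 + P2 = 1)
    (σ : H →ₗ[𝕂] H)
    (hσ00 : LinearMap.adjoint (P0 ∘ₗ (σ ∘ₗ P0)) = P0 ∘ₗ (σ ∘ₗ P0))
    (hσ11 : LinearMap.adjoint (P1 ∘ₗ (σ ∘ₗ P1)) = P1 ∘ₗ (σ ∘ₗ P1))
    (hσ01 : LinearMap.adjoint (P0 ∘ₗ (σ ∘ₗ P1)) = P1 ∘ₗ (σ ∘ₗ P0))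
    (hker : LinearMap.ker (P1 ∘ₗ (σ ∘ₗ P1)) ≤ LinearMap.ker (P0 ∘ₗ (σ ∘ₗ P1)))
    (B : H →ₗ[𝕂] H)
    (hB1 : B ∘ₗ ((P1 ∘ₗ (σ ∘ₗ P1)) ∘ₗ B) = B)
    (hB2 : (P1 ∘ₗ (σ ∘ₗ P1)) ∘ₗ (B ∘ₗ (P1 ∘ₗ (σ ∘ₗ P1))) = P1 ∘ₗ (σ ∘ₗ P1))
    (hB3 : LinearMap.adjoint (B ∘ₗ (P1 ∘ₗ (σ ∘ₗ P1))) = B ∘ₗ (P1 ∘ₗ (σ ∘ₗ P1)))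
    (hB4 : LinearMap.adjoint ((P1 ∘ₗ (σ ∘ₗ P1)) ∘ₗ B) = (P1 ∘ₗ (σ ∘ₗ P1)) ∘ₗ B) :
    ∀ E₀ : H, P0 E₀ = E₀ →
      ∀ J₀ E J : H,
        (P0 J₀ = J₀ ∧ P1 E = E ∧ P2 J = J ∧ J₀ + J = σ (E₀ + E)) ↔
          ((∃ K : H, P1 K = K ∧ (P1 ∘ₗ (σ ∘ₗ P1)) K = 0 ∧
              E = -(B ((P1 ∘ₗ (σ ∘ₗ P0)) E₀)) + K) ∧
            J₀ = gschurLM P0 P1 σ B E₀ ∧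
            J = (P2 ∘ₗ (σ ∘ₗ P0)) E₀ + (P2 ∘ₗ (σ ∘ₗ P1)) E) := by
  have hPS : P1 ∘ₗ (P1 ∘ₗ (σ ∘ₗ P1)) = P1 ∘ₗ (σ ∘ₗ P1) := by
    rw [← LinearMap.comp_assoc, hP1]
  have hPB (x : H) : P1 (B x) = B x :=
    LinearMap.congr_fun (comp_pinv_eq_self hσ11 hPS hB1 hB3) x
  have hSB (x : H) : P1 (σ (P1 (B (P1 (σ (P0 x)))))) = P1 (σ (P0 x)) := by
    have h := comp_pinv_comp_adjoint_eq hσ11 hker hB2 hB4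
    rw [hσ01] at h
    exact LinearMap.congr_fun h x
  have hker' (x : H) (hx : P1 (σ (P1 x)) = 0) : P0 (σ (P1 x)) = 0 := hker hx
  have p00 (x : H) : P0 (P0 x) = P0 x := LinearMap.congr_fun hP0 x
  have p22 (x : H) : P2 (P2 x) = P2 x := LinearMap.congr_fun hP2 x
  have p02 (x : H) : P0 (P2 x) = 0 := LinearMap.congr_fun h02 x
  have p12 (x : H) : P1 (P2 x) = 0 := LinearMap.congr_fun h12 x
  have p10 (x : H) : P1 (P0 x) = 0 :=
    LinearMap.congr_fun (comp_eq_zero_of_adjoint_eq hP0sa hP1sa h01) x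
  have p20 (x : H) : P2 (P0 x) = 0 :=
    LinearMap.congr_fun (comp_eq_zero_of_adjoint_eq hP0sa hP2sa h02) x
  have psum (x : H) : P0 x + P1 x + P2 x = x := LinearMap.congr_fun hsum x
  intro E₀ hE₀ J₀ E J
  have hSB' : P1 (σ (B (P1 (σ E₀)))) = P1 (σ E₀) := by
    simpa only [hPB, hE₀] using hSB E₀
  simp only [gschurLM, LinearMap.sub_apply, LinearMap.comp_apply, hPB, hE₀]
  constructor
  · rintro ⟨hJ₀, hE, hJ, h⟩
    have e0 : J₀ = P0 (σ E₀) + P0 (σ E) := by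
      have := congrArg P0 h
      rwa [← hJ, map_add, p02, hJ₀, add_zero, map_add, map_add] at this
    have e1 : 0 = P1 (σ E₀) + P1 (σ E) := by
      have := congrArg P1 h
      rwa [← hJ, ← hJ₀, map_add, p12, p10, add_zero, map_add, map_add] at this
    have e2 : J = P2 (σ E₀) + P2 (σ E) := by
      have := congrArg P2 h
      rwa [← hJ₀, map_add, p20, hJ, zero_add, map_add, map_add] at this
    have hK : P1 (E + B (P1 (σ E₀))) = E + B (P1 (σ E₀)) := by rw [map_add, hE, hPB]
    have hSK : P1 (σ (P1 (E + B (P1 (σ E₀))))) = 0 := by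
      rw [hK, map_add, map_add, hSB', add_comm, ← e1]
    have hTK := hker' _ hSK
    rw [hK, map_add, map_add] at hTK
    refine ⟨⟨_, hK, hSK, by abel⟩, ?_, by rw [hE, e2]⟩
    rw [e0, eq_neg_of_add_eq_zero_left hTK, sub_eq_add_neg]
  · rintro ⟨⟨K, hK, hSK, hE⟩, hJ₀, hJ⟩
    have hTK := hker' K hSK
    rw [hK] at hSK hTK
    have hPE : P1 E = E := by rw [hE, map_add, map_neg, hPB, hK]
    rw [hPE] at hJ
    refine ⟨by rw [hJ₀, map_sub, p00, p00], hPE, by rw [hJ, map_add, p22, p22], ?_⟩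
    have e0 : J₀ = P0 (σ (E₀ + E)) := by
      simp only [hJ₀, hE, map_add, map_neg, hTK]
      abel
    have e1 : P1 (σ (E₀ + E)) = 0 := by
      simp only [hE, map_add, map_neg, hSK, hSB']
      abel
    have e2 : J = P2 (σ (E₀ + E)) := by rw [hJ, map_add, map_add]
    rw [e0, e2, ← psum (σ (E₀ + E)), e1]
    simp only [map_add, p00, p22, p02, p20, add_zero, zero_add]
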